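/- Let U ⊆ ℂ be open, let A : U → ℂ be smooth on U, and let p : U → ℂ be smooth on U and satisfy the equation ∂̄p(z) = A(z)·p(z) for all z ∈ U. Then p is of holomorphic type on U; that is, every point z₀ ∈ U has an open neighborhood V ⊆ U on which p = p₀·p₁ with p₀ holomorphic on V and p₁ smooth and nonvanishing on V. -/

import Mathlib

/-- `∂p/∂x` of `p : ℂ → ℂ` at `z`, identifying `ℂ` with `ℝ²`. -/
noncomputable def pdx (p : ℂ → ℂ) (z : ℂ) : ℂ := fderiv ℝ p z 1

/-- `∂p/∂y` of `p : ℂ → ℂ` at `z`. -/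
noncomputable def pdy (p : ℂ → ℂ) (z : ℂ) : ℂ := fderiv ℝ p z Complex.I

/-- The Wirtinger derivative `∂̄p = ½(∂p/∂x + i ∂p/∂y)`. -/
noncomputable def wirtingerBar (p : ℂ → ℂ) (z : ℂ) : ℂ :=
  (1 / 2 : ℂ) * (pdx p z + Complex.I * pdy p z)

/-- `p : ℂ → ℂ` is of holomorphic type on an open set `U`: every point of `U` has an open
neighborhood `V ⊆ U` on which `p = p₀ * p₁`, with `p₀` holomorphic on `V` and `p₁` smooth
and nonvanishing on `V`. -/
def HolomorphicType (p : ℂ → ℂ) (U : Set ℂ) : Prop :=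
  ∀ z ∈ U, ∃ V : Set ℂ, IsOpen V ∧ z ∈ V ∧ V ⊆ U ∧
    ∃ p₀ p₁ : ℂ → ℂ, DifferentiableOn ℂ p₀ V ∧ ContDiffOn ℝ (⊤ : ℕ∞) p₁ V ∧
      (∀ w ∈ V, p₁ w ≠ 0) ∧ (∀ w ∈ V, p w = p₀ w * p₁ w)

open MeasureTheory Set Metric

lemma differentiableAt_complex_of_wirtingerBar_eq_zero {f : ℂ → ℂ} {z : ℂ}
    (hf : DifferentiableAt ℝ f z) (h : wirtingerBar f z = 0) : DifferentiableAt ℂ f z := by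
  refine differentiableAt_complex_iff_differentiableAt_real.2 ⟨hf, ?_⟩
  simp only [wirtingerBar, pdx, pdy] at h
  rw [smul_eq_mul]
  linear_combination (-2 * Complex.I) * h + (fderiv ℝ f z Complex.I) * Complex.I_mul_I

lemma wirtingerBar_mul {f g : ℂ → ℂ} {z : ℂ} (hf : DifferentiableAt ℝ f z)
    (hg : DifferentiableAt ℝ g z) :
    wirtingerBar (fun w => f w * g w) z = wirtingerBar f z * g z + f z * wirtingerBar g z := by
  simp only [wirtingerBar, pdx, pdy, fderiv_fun_mul hf hg, add_apply, smul_apply, smul_eq_mul]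
  ring

lemma wirtingerBar_cexp_neg {u : ℂ → ℂ} {z : ℂ} (hu : DifferentiableAt ℝ u z) :
    wirtingerBar (fun w => Complex.exp (-u w)) z = -(Complex.exp (-u z) * wirtingerBar u z) := by
  have h : HasFDerivAt (fun w => Complex.exp (-u w)) (Complex.exp (-u z) • -fderiv ℝ u z) z :=
    hu.hasFDerivAt.neg.cexp
  simp only [wirtingerBar, pdx, pdy, h.fderiv, smul_apply, neg_apply, smul_eq_mul]
  ring

lemma locallyIntegrable_inv : LocallyIntegrable (fun z : ℂ => z⁻¹) := by
  refine locallyIntegrable_of_norm_le_rpow (C := 1) (α := 1) (by simp) (by simp) ?_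
    measurable_inv.aestronglyMeasurable
  filter_upwards with z
  simp [Real.rpow_neg_one]

/-- `∂̄` in the rotated orthonormal frame `(e, i e)`, `e = cos θ + i sin θ`. -/
lemma wirtingerBar_rotated_frame (h : ℂ → ℂ) (z : ℂ) (θ : ℝ) :
    (Complex.exp (θ * Complex.I))⁻¹ * wirtingerBar h z =
      (1 / 2 : ℂ) * (fderiv ℝ h z (Complex.exp (θ * Complex.I)) +
        Complex.I * fderiv ℝ h z (Complex.I * Complex.exp (θ * Complex.I))) := by
  have h₁ : Complex.exp (θ * Complex.I) = Real.cos θ • (1 : ℂ) + Real.sin θ • Complex.I := by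
    simp [Complex.exp_mul_I]
  have h₂ : Complex.I * Complex.exp (θ * Complex.I) =
      (-Real.sin θ) • (1 : ℂ) + Real.cos θ • Complex.I := by
    simp only [h₁, Complex.real_smul, Complex.ofReal_neg]
    linear_combination (Real.sin θ : ℂ) * Complex.I_mul_I
  have h₃ : (Complex.exp (θ * Complex.I))⁻¹ = Real.cos θ - Real.sin θ * Complex.I := by
    rw [← Complex.exp_neg, ← neg_mul, Complex.exp_mul_I]
    simp [sub_eq_add_neg]
  rw [h₃, h₂, h₁]
  simp only [map_add, map_smul, wirtingerBar, pdx, pdy]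
  simp only [Complex.real_smul, Complex.ofReal_neg]
  linear_combination (-1 / 2 * (Real.sin θ : ℂ) * fderiv ℝ h z Complex.I) * Complex.I_mul_I

/-- Cauchy–Pompeiu formula for compactly supported functions, at the origin. -/
lemma integral_inv_mul_wirtingerBar {h : ℂ → ℂ} (hh : ContDiff ℝ 1 h)
    (hc : HasCompactSupport h) :
    ∫ z : ℂ, z⁻¹ * wirtingerBar h z = -(Real.pi * h 0) := by
  have hD : Continuous (fderiv ℝ h) := hh.continuous_fderiv one_ne_zero
  obtain ⟨R, hR⟩ := (hc.fderiv ℝ).isCompact.isBounded.subset_closedBall 0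
  have hzero (r θ : ℝ) (hr : R < r) (hr0 : 0 < r) :
      fderiv ℝ h (r * Complex.exp (θ * Complex.I)) = 0 := by
    refine image_eq_zero_of_notMem_tsupport fun hmem => ?_
    have := hR hmem
    simp [abs_of_pos hr0] at this
    linarith
  let D (v : ℂ) (q : ℝ × ℝ) : ℂ :=
    fderiv ℝ h (q.1 * Complex.exp (q.2 * Complex.I)) (v * Complex.exp (q.2 * Complex.I))
  have hDint (v : ℂ) :
      IntegrableOn (D v) (Ioi 0 ×ˢ Ioo (-Real.pi) Real.pi) (volume.prod volume) := by
    have hcont : Continuous (D v) := by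
      refine (hD.comp ?_).clm_apply ?_ <;> fun_prop
    have hK : IntegrableOn (D v) (Icc 0 R ×ˢ Icc (-Real.pi) Real.pi) (volume.prod volume) :=
      hcont.continuousOn.integrableOn_compact (isCompact_Icc.prod isCompact_Icc)
    refine hK.of_forall_sdiff_eq_zero (measurableSet_Ioi.prod measurableSet_Ioo) ?_
    rintro ⟨r, θ⟩ ⟨⟨hr, hθ⟩, hn⟩
    have hr' : R < r := by
      by_contra! hle
      exact hn ⟨⟨(mem_Ioi.1 hr).le, hle⟩, Ioo_subset_Icc_self hθ⟩
    simp [D, hzero r θ hr' hr]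
  have hradial : ∫ q in Ioi 0 ×ˢ Ioo (-Real.pi) Real.pi, D 1 q ∂volume.prod volume =
      -(2 * Real.pi * h 0) := by
    have hint := hDint 1
    rw [IntegrableOn, ← Measure.prod_restrict] at hint
    rw [← Measure.prod_restrict, integral_prod_symm _ hint]
    have hray (θ : ℝ) : ∫ r in Ioi (0 : ℝ), D 1 (r, θ) = -h 0 := by
      have hl : ContDiff ℝ 1 fun r : ℝ => (r : ℂ) * Complex.exp (θ * Complex.I) :=
        Complex.ofRealCLM.contDiff.mul contDiff_const
      have hsupp : HasCompactSupport fun r : ℝ => h (r * Complex.exp (θ * Complex.I)) := by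
        obtain ⟨S, hS⟩ := hc.isCompact.isBounded.subset_closedBall 0
        refine HasCompactSupport.intro (isCompact_Icc (a := -S) (b := S)) fun r hr => ?_
        refine image_eq_zero_of_notMem_tsupport fun hmem => hr ?_
        have := hS hmem
        simpa [abs_le] using this
      have hder (r : ℝ) : deriv (fun r : ℝ => h (r * Complex.exp (θ * Complex.I))) r =
          D 1 (r, θ) := by
        have hlin : HasDerivAt (fun r : ℝ => (r : ℂ) * Complex.exp (θ * Complex.I))
            (1 * Complex.exp (θ * Complex.I)) r :=
          (Complex.ofRealCLM.hasDerivAt (x := r)).mul_const _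
        exact ((hh.differentiable one_ne_zero _).hasFDerivAt.comp_hasDerivAt r hlin).deriv
      have := hsupp.integral_Ioi_deriv_eq (hh.comp hl) 0
      simpa [Function.comp_def, hder] using this
    simp only [hray]
    simp [Real.pi_pos.le, two_mul]
  have hangular : ∫ q in Ioi 0 ×ˢ Ioo (-Real.pi) Real.pi, D Complex.I q ∂volume.prod volume =
      0 := by
    rw [setIntegral_prod _ (hDint _)]
    refine setIntegral_eq_zero_of_forall_eq_zero fun r (hr : 0 < r) => ?_
    have hder (θ : ℝ) : HasDerivAt (fun θ : ℝ => h (r * Complex.exp (θ * Complex.I)))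
        (r • D Complex.I (r, θ)) θ := by
      have hlin : HasDerivAt (fun θ : ℝ => (r : ℂ) * Complex.exp (θ * Complex.I))
          (r • (Complex.I * Complex.exp (θ * Complex.I))) θ := by
        have := (((Complex.ofRealCLM.hasDerivAt (x := θ)).mul_const Complex.I).cexp).const_mul
          (r : ℂ)
        refine this.congr_deriv ?_
        simp only [Complex.ofRealCLM_apply, Complex.ofReal_one, Complex.real_smul]
        ring
      have := (hh.differentiable one_ne_zero _).hasFDerivAt.comp_hasDerivAt θ hlin
      rwa [map_smul] at this
    have hcont : Continuous fun θ : ℝ => r • D Complex.I (r, θ) := by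
      refine Continuous.const_smul ((hD.comp ?_).clm_apply ?_) r <;> fun_prop
    have := intervalIntegral.integral_eq_sub_of_hasDerivAt (fun θ _ => hder θ)
      (hcont.intervalIntegrable (-Real.pi) Real.pi)
    rw [intervalIntegral.integral_of_le (by linarith [Real.pi_pos]), integral_Ioc_eq_integral_Ioo,
      integral_smul] at this
    have hends : Complex.exp (((-Real.pi : ℝ) : ℂ) * Complex.I) =
        Complex.exp ((Real.pi : ℂ) * Complex.I) := by
      rw [Complex.ofReal_neg, neg_mul, Complex.exp_neg, Complex.exp_pi_mul_I]
      norm_num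
    rw [hends, sub_self] at this
    exact (smul_eq_zero.1 this).resolve_left hr.ne'
  calc ∫ z : ℂ, z⁻¹ * wirtingerBar h z
      = ∫ q in Ioi 0 ×ˢ Ioo (-Real.pi) Real.pi,
          ((1 / 2 : ℂ) * (D 1 q + Complex.I * D Complex.I q)) ∂volume.prod volume := by
        rw [← Complex.integral_comp_polarCoord_symm]
        refine setIntegral_congr_fun (measurableSet_Ioi.prod measurableSet_Ioo) ?_
        rintro ⟨r, θ⟩ ⟨hr, -⟩
        have hr0 : (r : ℂ) ≠ 0 := by exact_mod_cast (mem_Ioi.1 hr).ne'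
        have hpolar : Complex.polarCoord.symm (r, θ) = r * Complex.exp (θ * Complex.I) := by
          simp [Complex.polarCoord_symm_apply, Complex.exp_mul_I]
        simp only [hpolar, D, one_mul, ← wirtingerBar_rotated_frame, Complex.real_smul, mul_inv]
        rw [← mul_assoc, ← mul_assoc, mul_inv_cancel₀ hr0, one_mul]
    _ = -(Real.pi * h 0) := by
        rw [integral_const_mul, integral_add (hDint 1) ((hDint Complex.I).const_mul _),
          integral_const_mul, hradial, hangular]
        ring

lemma wirtingerBar_comp_const_sub {g : ℂ → ℂ} {x z : ℂ} (hg : DifferentiableAt ℝ g (x - z)) :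
    wirtingerBar (fun t => g (x - t)) z = -wirtingerBar g (x - z) := by
  have h (v : ℂ) : fderiv ℝ (fun t => g (x - t)) z v = -fderiv ℝ g (x - z) v := by
    have := (hg.hasFDerivAt.comp z ((hasFDerivAt_id (𝕜 := ℝ) z).const_sub x)).fderiv
    simpa [Function.comp_def] using DFunLike.congr_fun this v
  simp only [wirtingerBar, pdx, pdy, h]
  ring

/-- The `∂̄`-equation with smooth compactly supported right-hand side has a smooth solution. -/
lemma exists_contDiff_wirtingerBar_eq {g : ℂ → ℂ} (hg : ContDiff ℝ (⊤ : ℕ∞) g)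
    (hc : HasCompactSupport g) :
    ∃ u : ℂ → ℂ, ContDiff ℝ (⊤ : ℕ∞) u ∧ ∀ z, wirtingerBar u z = g z := by
  let L := ContinuousLinearMap.mul ℝ ℂ
  let c : ℂ → ℂ := convolution (fun z : ℂ => z⁻¹) g L volume
  have hg1 : ContDiff ℝ 1 g := hg.of_le (by exact_mod_cast le_top)
  have hcs : ContDiff ℝ (⊤ : ℕ∞) c := hc.contDiff_convolution_right L locallyIntegrable_inv hg
  have hD : Continuous (fderiv ℝ g) := hg1.continuous_fderiv one_ne_zero
  have hfd (z v : ℂ) : fderiv ℝ c z v = ∫ t : ℂ, t⁻¹ * fderiv ℝ g (z - t) v := by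
    rw [(hc.hasFDerivAt_convolution_right L locallyIntegrable_inv hg1 z).fderiv,
      convolution_precompR_apply L locallyIntegrable_inv (hc.fderiv ℝ) hD]
    rfl
  have hint (z v : ℂ) : Integrable fun t : ℂ => t⁻¹ * fderiv ℝ g (z - t) v :=
    (hc.fderiv_apply ℝ v).convolutionExists_right L locallyIntegrable_inv
      (hD.clm_apply continuous_const) z
  have hbar (z : ℂ) : wirtingerBar c z = Real.pi * g z := by
    have hpompeiu := integral_inv_mul_wirtingerBar (h := fun t => g (z - t))
      (hg1.comp (contDiff_const.sub contDiff_id))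
      (hc.comp_homeomorph (Homeomorph.subLeft z))
    simp only [wirtingerBar_comp_const_sub (hg1.differentiable one_ne_zero _), mul_neg, integral_neg,
      sub_zero, neg_inj] at hpompeiu
    rw [← hpompeiu]
    simp only [wirtingerBar, pdx, pdy, hfd]
    rw [← integral_const_mul, ← integral_add (hint z 1) ((hint z _).const_mul _),
      ← integral_const_mul]
    congr 1 with t
    ring
  refine ⟨fun z => (Real.pi : ℂ)⁻¹ * c z, contDiff_const.mul hcs, fun z => ?_⟩
  have hpi : (Real.pi : ℂ) ≠ 0 := by exact_mod_cast Real.pi_ne_zero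
  have hconst : wirtingerBar (fun _ : ℂ => (Real.pi : ℂ)⁻¹) z = 0 := by
    simp [wirtingerBar, pdx, pdy]
  rw [wirtingerBar_mul (differentiableAt_const _)
    (hcs.differentiable (by simp) z), hconst, hbar, zero_mul, zero_add,
    inv_mul_cancel_left₀ hpi]

/-- A function smooth on a neighbourhood of `z` agrees near `z` with a smooth compactly supported
function. -/
lemma exists_contDiff_hasCompactSupport_eqOn_ball {A : ℂ → ℂ} {U : Set ℂ} (hU : IsOpen U)
    (hA : ContDiffOn ℝ (⊤ : ℕ∞) A U) {z : ℂ} (hz : z ∈ U) :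
    ∃ r > 0, ball z r ⊆ U ∧ ∃ g : ℂ → ℂ, ContDiff ℝ (⊤ : ℕ∞) g ∧ HasCompactSupport g ∧
      EqOn g A (ball z r) := by
  obtain ⟨ε, hε, hεU⟩ := nhds_basis_closedBall.mem_iff.1 (hU.mem_nhds hz)
  let χ : ContDiffBump z := ⟨ε / 2, ε, half_pos hε, half_lt_self hε⟩
  refine ⟨ε / 2, half_pos hε, ((ball_subset_ball (half_le_self hε.le)).trans
    ball_subset_closedBall).trans hεU, fun w => χ w • A w, ?_, χ.hasCompactSupport.smul_right, ?_⟩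
  · refine contDiff_iff_contDiffAt.2 fun w => ?_
    by_cases hw : w ∈ closedBall z ε
    · exact χ.contDiff.contDiffAt.smul (hA.contDiffAt (hU.mem_nhds (hεU hw)))
    · refine contDiffAt_const (c := (0 : ℂ)).congr_of_eventuallyEq ?_
      filter_upwards [isClosed_closedBall.isOpen_compl.mem_nhds hw] with y hy
      have : χ y = 0 := χ.zero_of_le_dist (not_le.1 fun hle => hy (mem_closedBall.2 hle)).le
      simp [this]
  · intro w hw
    simp [χ.one_of_mem_closedBall (ball_subset_closedBall hw)]

/-- A smooth solution `p` of `∂̄p = A·p` on an open set `U ⊆ ℂ`, with `A` smooth on `U`,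
is of holomorphic type on `U`. -/
theorem smooth_dbar_eq_mul_holomorphicType
    (U : Set ℂ) (hU : IsOpen U)
    (A p : ℂ → ℂ) (hA : ContDiffOn ℝ (⊤ : ℕ∞) A U) (hp : ContDiffOn ℝ (⊤ : ℕ∞) p U)
    (heq : ∀ z ∈ U, wirtingerBar p z = A z * p z) :
    HolomorphicType p U := by
  intro z hz
  obtain ⟨r, hr, hrU, g, hg, hgc, hgA⟩ := exists_contDiff_hasCompactSupport_eqOn_ball hU hA hz
  obtain ⟨u, hu, hug⟩ := exists_contDiff_wirtingerBar_eq hg hgc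
  refine ⟨ball z r, isOpen_ball, mem_ball_self hr, hrU, fun w => p w * Complex.exp (-u w),
    fun w => Complex.exp (u w), fun w hw => ?_, hu.cexp.contDiffOn,
    fun w _ => Complex.exp_ne_zero _, fun w _ => ?_⟩
  · have hud : DifferentiableAt ℝ u w := hu.differentiable (by simp) w
    have hpd : DifferentiableAt ℝ p w :=
      (hp.contDiffAt (hU.mem_nhds (hrU hw))).differentiableAt (by simp)
    refine (differentiableAt_complex_of_wirtingerBar_eq_zero (hpd.mul hud.neg.cexp)
      ?_).differentiableWithinAt
    refine (wirtingerBar_mul hpd hud.neg.cexp).trans ?_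
    simp only [Pi.neg_apply]
    rw [wirtingerBar_cexp_neg hud, heq w (hrU hw), hug, hgA hw]
    ring
  · rw [mul_assoc, ← Complex.exp_add, neg_add_cancel, Complex.exp_zero, mul_one]
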